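/- arXiv:1605.00169 — 3 statements merged into one kernel-verified Lean document; each statement's English description precedes it below -/
import Mathlib

section
/- Let S and A be finite nonempty types, let γ ∈ [0,1) be a discount factor, let T : S → A → PMF S be a transition function, and let R : S → A → ℝ be a reward function with −1 ≤ R(s,a) ≤ 0 for all s, a. Suppose s_inv ∈ S is an absorbing failure state, i.e. T(s_inv, a) = PMF.pure s_inv and R(s_inv, a) = −1 for every action a. Let V : S → ℝ satisfy the Bellman optimality equation. If s ∈ S and a_inf ∈ A are such that T(s, a_inf) = PMF.pure s_inv and R(s, a_inf) = −1, and if V(s) > −1/(1−γ), then a_inf does not attain the maximum in the Bellman optimality equation at s; that is, R(s, a_inf) + γ ∑_{s'} T(s, a_inf)(s')·V(s') < V(s). -/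
/-- The expectation of `f` under a point mass at `a` is `f a`. -/
theorem PMF.sum_toReal_pure_mul {S : Type*} [Fintype S] (a : S) (f : S → ℝ) :
    ∑ x, (PMF.pure a x).toReal * f x = f a := by
  classical
  rw [Finset.sum_eq_single a] <;> simp +contextual [PMF.pure_apply]

/-- In a finite MDP with rewards in [-1,0] and an absorbing
failure state `s_inv`, if an action `a_inf` at `s` deterministically leads to
`s_inv` with reward -1, and the Bellman-optimal value `V s > -1/(1-γ)`, then
`a_inf` does not attain the maximum in the Bellman optimality equation at `s`. -/
theorem stmt_0 {S A : Type*} [Fintype S] [Fintype A] [Nonempty S] [Nonempty A]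
    (γ : ℝ) (hγ0 : 0 ≤ γ) (hγ1 : γ < 1)
    (T : S → A → PMF S) (R : S → A → ℝ)
    (hR : ∀ s a, -1 ≤ R s a ∧ R s a ≤ 0)
    (s_inv : S)
    (hTinv : ∀ a, T s_inv a = PMF.pure s_inv)
    (hRinv : ∀ a, R s_inv a = -1)
    (V : S → ℝ)
    (hBellman : ∀ s, V s = Finset.univ.sup' Finset.univ_nonempty
      (fun a => R s a + γ * ∑ s', (T s a s').toReal * V s'))
    (s : S) (a_inf : A)
    (hT : T s a_inf = PMF.pure s_inv) (hRinf : R s a_inf = -1)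
    (hV : V s > -1 / (1 - γ)) :
    R s a_inf + γ * ∑ s', (T s a_inf s').toReal * V s' < V s := by
  have h_inv : V s_inv = -1 + γ * V s_inv := by
    simpa only [hTinv, hRinv, PMF.sum_toReal_pure_mul, Finset.sup'_const] using hBellman s_inv
  have h_val : V s_inv = -1 / (1 - γ) := by
    rw [eq_div_iff (by linarith)]
    linarith
  rw [hT, hRinf, PMF.sum_toReal_pure_mul, ← h_inv, h_val]
  exact hV
end

section
/- Let S and A be finite nonempty types, let γ ∈ [0,1) be a discount factor, and let s_inv ∈ S. Consider two Markov decision processes on the same state and action spaces: a relaxed model with transition function T_rel : S → A → PMF S and reward R_rel : S → A → ℝ satisfying −1 ≤ R_rel(s,a) ≤ 0 for all s, a; and a constrained model with transition function T_lat and reward R_lat such that for every pair (s,a), either (T_lat(s,a), R_lat(s,a)) = (T_rel(s,a), R_rel(s,a)), or T_lat(s,a) = PMF.pure s_inv and R_lat(s,a) = −1 (such pairs are called infeasible). Assume every action at s_inv is infeasible in the constrained model. If V_rel : S → ℝ satisfies the Bellman optimality equation of the relaxed model and V_lat : S → ℝ satisfies the Bellman optimality equation of the constrained model, then V_lat(s)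 ≤ V_rel(s) for every s ∈ S. -/
theorem PMF.sum_toReal_eq_one {S : Type*} [Fintype S] (p : PMF S) :
    ∑ s, (p s).toReal = 1 := by
  rw [← ENNReal.toReal_sum fun s _ => p.apply_ne_top s, ← tsum_fintype (L := .unconditional S),
    p.tsum_coe, ENNReal.toReal_one]

theorem PMF.sum_toReal_mul_le_add {S : Type*} [Fintype S] (p : PMF S) {f g : S → ℝ} {c : ℝ}
    (h : ∀ s, f s ≤ g s + c) :
    ∑ s, (p s).toReal * f s ≤ ∑ s, (p s).toReal * g s + c := by
  calc ∑ s, (p s).toReal * f s ≤ ∑ s, (p s).toReal * (g s + c) :=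
        Finset.sum_le_sum fun s _ => mul_le_mul_of_nonneg_left (h s) ENNReal.toReal_nonneg
    _ = ∑ s, (p s).toReal * g s + c := by
        simp only [mul_add, Finset.sum_add_distrib, ← Finset.sum_mul, p.sum_toReal_eq_one, one_mul]

theorem PMF.sum_pure_toReal_mul {S : Type*} [Fintype S] (a : S) (f : S → ℝ) :
    ∑ s, (PMF.pure a s).toReal * f s = f a := by
  classical
  rw [Finset.sum_eq_single a] <;> simp +contextual [PMF.pure_apply]

/-- The optimal value function of a relaxed MDP upper-bounds the
optimal value function of a constrained MDP in which each state-action pair is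
either identical to the relaxed model or infeasible (deterministically leading
to the absorbing invalid state `s_inv` with reward -1), provided every action
at `s_inv` is infeasible. -/
theorem stmt_3 {S A : Type*} [Fintype S] [Fintype A] [Nonempty S] [Nonempty A]
    (γ : ℝ) (hγ0 : 0 ≤ γ) (hγ1 : γ < 1)
    (s_inv : S)
    (T_rel : S → A → PMF S) (R_rel : S → A → ℝ)
    (hRrel : ∀ s a, -1 ≤ R_rel s a ∧ R_rel s a ≤ 0)
    (T_lat : S → A → PMF S) (R_lat : S → A → ℝ)
    (hLat : ∀ s a, (T_lat s a = T_rel s a ∧ R_lat s a = R_rel s a) ∨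
      (T_lat s a = PMF.pure s_inv ∧ R_lat s a = -1))
    (hInv : ∀ a, T_lat s_inv a = PMF.pure s_inv ∧ R_lat s_inv a = -1)
    (V_rel : S → ℝ)
    (hBellmanRel : ∀ s, V_rel s = Finset.univ.sup' Finset.univ_nonempty
      (fun a => R_rel s a + γ * ∑ s', (T_rel s a s').toReal * V_rel s'))
    (V_lat : S → ℝ)
    (hBellmanLat : ∀ s, V_lat s = Finset.univ.sup' Finset.univ_nonempty
      (fun a => R_lat s a + γ * ∑ s', (T_lat s a s').toReal * V_lat s')) :
    ∀ s, V_lat s ≤ V_rel s := by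
  have hRel : ∀ s a, R_rel s a + γ * ∑ s', (T_rel s a s').toReal * V_rel s' ≤ V_rel s := by
    intro s a
    rw [hBellmanRel s]
    exact Finset.le_sup' (fun a => R_rel s a + γ * ∑ s', (T_rel s a s').toReal * V_rel s')
      (Finset.mem_univ a)
  have hLatAttained : ∀ s, ∃ a,
      V_lat s = R_lat s a + γ * ∑ s', (T_lat s a s').toReal * V_lat s' := by
    intro s
    obtain ⟨a, -, ha⟩ := Finset.exists_mem_eq_sup' (Finset.univ_nonempty (α := A))
      (fun a => R_lat s a + γ * ∑ s', (T_lat s a s').toReal * V_lat s')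
    exact ⟨a, (hBellmanLat s).trans ha⟩
  have hInvValue : V_lat s_inv = -1 + γ * V_lat s_inv := by
    obtain ⟨a, ha⟩ := hLatAttained s_inv
    rwa [(hInv a).1, (hInv a).2, PMF.sum_pure_toReal_mul] at ha
  have hInvLe : ∀ s, V_lat s_inv ≤ V_rel s := by
    obtain ⟨s₀, hs₀⟩ := Finite.exists_min V_rel
    obtain ⟨a⟩ := ‹Nonempty A›
    have hExp := (T_rel s₀ a).sum_toReal_mul_le_add (f := fun _ => 0) (g := V_rel)
      (c := -V_rel s₀) fun s => by linarith [hs₀ s]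
    simp only [mul_zero, Finset.sum_const_zero] at hExp
    have hBound := hRel s₀ a
    have hReward := (hRrel s₀ a).1
    intro s
    refine le_trans ?_ (hs₀ s)
    nlinarith [mul_nonneg hγ0 hExp]
  obtain ⟨s₀, hs₀⟩ := Finite.exists_max fun s => V_lat s - V_rel s
  suffices h : V_lat s₀ ≤ V_rel s₀ from fun s => by linarith [hs₀ s]
  obtain ⟨a, ha⟩ := hLatAttained s₀
  rcases hLat s₀ a with ⟨hT, hR⟩ | ⟨hT, hR⟩
  · rw [hT, hR] at ha
    have hExp := (T_rel s₀ a).sum_toReal_mul_le_add (f := V_lat) (g := V_rel)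
      (c := V_lat s₀ - V_rel s₀) fun s => by linarith [hs₀ s]
    have hBound := hRel s₀ a
    nlinarith [mul_le_mul_of_nonneg_left hExp hγ0]
  · rw [hT, hR, PMF.sum_pure_toReal_mul, ← hInvValue] at ha
    exact ha ▸ hInvLe s₀
end

section
/- Let S and A be finite nonempty types, let γ ∈ [0,1) be a discount factor, let T : S → A → PMF S be a transition function, and let R : S → A → ℝ be a reward function with −1 ≤ R(s,a) ≤ 0 for all s, a. Let V : S → ℝ satisfy the Bellman optimality equation. If at a state s ∈ S there exists an action a ∈ A with R(s,a) > −1, then V(s) > −1/(1−γ). -/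
theorem PMF.le_sum_toReal_mul {S : Type*} [Fintype S] (p : PMF S) {f : S → ℝ} {c : ℝ}
    (hf : ∀ s, c ≤ f s) : c ≤ ∑ s, (p s).toReal * f s :=
  calc c = ∑ s, (p s).toReal * c := by rw [← Finset.sum_mul, p.sum_toReal_eq_one, one_mul]
    _ ≤ ∑ s, (p s).toReal * f s :=
      Finset.sum_le_sum fun s _ => mul_le_mul_of_nonneg_left (hf s) ENNReal.toReal_nonneg

/-- In a finite MDP with rewards in [-1,0], if at state s some
action has reward strictly greater than -1, then the Bellman-optimal value
satisfies V s > -1/(1-γ). -/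
theorem stmt_8 {S A : Type*} [Fintype S] [Fintype A] [Nonempty S] [Nonempty A]
    (γ : ℝ) (hγ0 : 0 ≤ γ) (hγ1 : γ < 1)
    (T : S → A → PMF S) (R : S → A → ℝ)
    (hR : ∀ s a, -1 ≤ R s a ∧ R s a ≤ 0)
    (V : S → ℝ)
    (hBellman : ∀ s, V s = Finset.univ.sup' Finset.univ_nonempty
      (fun a => R s a + γ * ∑ s', (T s a s').toReal * V s'))
    (s : S) (a : A) (ha : R s a > -1) :
    V s > -1 / (1 - γ) := by
  obtain ⟨m, hm⟩ := Finite.exists_min V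
  have key (s : S) (a : A) : R s a + γ * V m ≤ V s :=
    calc R s a + γ * V m ≤ R s a + γ * ∑ s', (T s a s').toReal * V s' := by
          gcongr
          exact (T s a).le_sum_toReal_mul hm
      _ ≤ V s := by
          rw [hBellman s]
          exact Finset.le_sup' (fun a => R s a + γ * ∑ s', (T s a s').toReal * V s')
            (Finset.mem_univ a)
  have hpos : 0 < 1 - γ := sub_pos.mpr hγ1
  have hVm : -1 / (1 - γ) ≤ V m := by
    rw [div_le_iff₀ hpos]
    linarith [key m a, (hR m a).1]
  have hfix : -1 / (1 - γ) = -1 + γ * (-1 / (1 - γ)) := by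
    field_simp
    ring
  linarith [key s a, mul_le_mul_of_nonneg_left hVm hγ0]
end
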